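/- Let (u_p)_{p>1} be a family of low energy nodal solutions of (P_p). There exists C > 0 such that for p large enough and i = 1,2, |v_{i,p}(z)| ≤ C log(2 + |z|) for all |z| ≤ ϱ₀/ε_{i,p}. -/

import Mathlib

open Real MeasureTheory Metric Filter Topology Bornology

noncomputable section

abbrev E2 : Type := EuclideanSpace ℝ (Fin 2)

/-- Laplacian of `u : ℝ² → ℝ` via coordinate second derivatives. -/
def lap (u : E2 → ℝ) (x : E2) : ℝ :=
  ∑ i : Fin 2,
    fderiv ℝ (fun y => fderiv ℝ u y (EuclideanSpace.single i 1)) x (EuclideanSpace.single i 1)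

/-- `u` is a (classical) solution of the Lane–Emden problem `(P_p)` on `Ω`. -/
def IsSolution (Ω : Set E2) (p : ℝ) (u : E2 → ℝ) : Prop :=
  ContDiffOn ℝ 2 u Ω ∧ ContinuousOn u (closure Ω) ∧
    (∀ x ∈ Ω, -lap u x = |u x| ^ (p - 1) * u x) ∧
    (∀ x ∈ frontier Ω, u x = 0)

/-- `u` is a nodal (sign-changing) function on `Ω`. -/
def IsNodal (Ω : Set E2) (u : E2 → ℝ) : Prop :=
  (∃ x ∈ Ω, 0 < u x) ∧ (∃ x ∈ Ω, u x < 0)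

/-- The Green function of `-Δ` on `Ω` with Dirichlet boundary conditions, together with
its regular part `H`, so that `G(x,y) = -(1/2π) log|x-y| + H(x,y)`. -/
structure GreenData (Ω : Set E2) where
  G : E2 → E2 → ℝ
  H : E2 → E2 → ℝ
  decomp : ∀ x y, G x y = -(1 / (2 * π)) * Real.log ‖x - y‖ + H x y
  bdry : ∀ x ∈ Ω, ∀ y ∈ frontier Ω, G x y = 0
  symm : ∀ x y, G x y = G y x
  smoothH : ContDiffOn ℝ (⊤ : ℕ∞) (fun q : E2 × E2 => H q.1 q.2) (Ω ×ˢ Ω)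
  contH : ∀ x ∈ Ω, ContinuousOn (H x) (closure Ω)
  harmH : ∀ x ∈ Ω, ∀ y ∈ Ω, lap (H x) y = 0

/-- The Kirchhoff–Routh type function `Ψ(a₁,a₂) = 2G(a₁,a₂) − R(a₁) − R(a₂)`. -/
def KR {Ω : Set E2} (gd : GreenData Ω) (q : E2 × E2) : ℝ :=
  2 * gd.G q.1 q.2 - gd.H q.1 q.1 - gd.H q.2 q.2

/-- `q` is a non-degenerate critical point of `F`. -/
def NondegCrit (F : E2 × E2 → ℝ) (q : E2 × E2) : Prop :=
  fderiv ℝ F q = 0 ∧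
    ∀ v : E2 × E2, (∀ w : E2 × E2, fderiv ℝ (fun r => fderiv ℝ F r) q v w = 0) → v = 0

/-- Convergence in `C²_loc(S)`: uniform convergence of all derivatives of order `≤ 2`
on compact subsets of `S`. -/
def TendstoC2LocOn (S : Set E2) (F : ℕ → E2 → ℝ) (g : E2 → ℝ) : Prop :=
  ∀ K : Set E2, K ⊆ S → IsCompact K → ∀ k : ℕ, k ≤ 2 →
    TendstoUniformlyOn (fun n x => iteratedFDeriv ℝ k (F n) x)
      (fun x => iteratedFDeriv ℝ k g x) atTop K

/-- `‖u⁺‖_∞` on `closure Ω`. -/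
def supPos (Ω : Set E2) (u : E2 → ℝ) : ℝ := sSup ((fun x => max (u x) 0) '' closure Ω)

/-- `‖u⁻‖_∞` on `closure Ω`. -/
def supNeg (Ω : Set E2) (u : E2 → ℝ) : ℝ := sSup ((fun x => max (-u x) 0) '' closure Ω)

/-- The energy functional `J_p`. -/
def energy (Ω : Set E2) (p : ℝ) (u : E2 → ℝ) : ℝ :=
  (1 / 2) * (∫ x in Ω, ‖fderiv ℝ u x‖ ^ 2) - (1 / (p + 1)) * ∫ x in Ω, |u x| ^ (p + 1)

/-- The standard bubble `U(z) = −2 log(1 + |z|²/8)`. -/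
def Ustd (z : E2) : ℝ := -2 * Real.log (1 + ‖z‖ ^ 2 / 8)

/-- Unit vector at angle `θ`. -/
def circDir (θ : ℝ) : E2 :=
  EuclideanSpace.single 0 (Real.cos θ) + EuclideanSpace.single 1 (Real.sin θ)

/-- Surface integral over the circle `∂B_r(c)`; the integrand may depend on the
outer unit normal (first argument) and on the point (second argument). -/
def surfInt (c : E2) (r : ℝ) (F : E2 → E2 → ℝ) : ℝ :=
  ∫ θ in (0:ℝ)..(2 * π), r * F (circDir θ) (c + r • circDir θ)

/-- Inner product of gradients `⟨∇f, ∇g⟩`. -/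
def gradInner (f g : E2 → ℝ) (x : E2) : ℝ :=
  ∑ j : Fin 2, fderiv ℝ f x (EuclideanSpace.single j 1) *
    fderiv ℝ g x (EuclideanSpace.single j 1)

/-- The quadratic form `P_i` (centred at `c`, radius `r`). -/
def Pform (c : E2) (r : ℝ) (f g : E2 → ℝ) : ℝ :=
  -2 * r * surfInt c r (fun ν x => fderiv ℝ f x ν * fderiv ℝ g x ν) +
    r * surfInt c r (fun _ x => gradInner f g x)

/-- The quadratic form `Q_{ij}` (centred at `c`, radius `r`). -/
def Qform (c : E2) (r : ℝ) (j : Fin 2) (f g : E2 → ℝ) : ℝ :=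
  surfInt c r (fun ν x =>
    -(fderiv ℝ f x (EuclideanSpace.single j 1)) * fderiv ℝ g x ν -
      fderiv ℝ f x ν * fderiv ℝ g x (EuclideanSpace.single j 1) +
      gradInner f g x * ν j)


/-! ### Circle means -/

lemma circDir_eq (t : ℝ) : circDir t = Real.cos t • EuclideanSpace.single 0 (1:ℝ) +
      Real.sin t • EuclideanSpace.single 1 (1:ℝ) := by
  ext i
  fin_cases i <;> simp [circDir]

lemma hasDerivAt_circDir (θ : ℝ) : HasDerivAt circDir (circDir (θ + π / 2)) θ := by
  have h : circDir = fun t => Real.cos t • EuclideanSpace.single 0 (1:ℝ) +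
      Real.sin t • EuclideanSpace.single 1 (1:ℝ) := funext circDir_eq
  rw [circDir_eq (θ + π / 2), Real.cos_add_pi_div_two, Real.sin_add_pi_div_two, h]
  exact ((Real.hasDerivAt_cos θ).smul_const _).add ((Real.hasDerivAt_sin θ).smul_const _)

lemma continuous_circDir : Continuous circDir :=
  continuous_iff_continuousAt.2 fun θ => (hasDerivAt_circDir θ).continuousAt

lemma norm_circDir (θ : ℝ) : ‖circDir θ‖ = 1 := by
  simp [circDir, EuclideanSpace.norm_eq]

lemma circDir_add_pi (θ : ℝ) : circDir (θ + π / 2 + π / 2) = -circDir θ := by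
  ext i
  fin_cases i <;> simp [circDir, add_assoc]

lemma hasDerivAt_param (F F' : ℝ → ℝ → ℝ) (R : ℝ)
    (hF : ContinuousOn (fun q : ℝ × ℝ => F q.1 q.2) (Set.Ioo (-R) R ×ˢ Set.univ))
    (hF' : ContinuousOn (fun q : ℝ × ℝ => F' q.1 q.2) (Set.Ioo (-R) R ×ˢ Set.univ))
    (hd : ∀ r ∈ Set.Ioo (-R) R, ∀ θ, HasDerivAt (fun s => F s θ) (F' r θ) r)
    (r : ℝ) (hr : r ∈ Set.Ioo (-R) R) :
    HasDerivAt (fun s => ∫ θ in (-π)..π, F s θ) (∫ θ in (-π)..π, F' r θ) r := by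
  have hc : ∀ G : ℝ → ℝ → ℝ,
      ContinuousOn (fun q : ℝ × ℝ => G q.1 q.2) (Set.Ioo (-R) R ×ˢ Set.univ) →
      ∀ s ∈ Set.Ioo (-R) R, Continuous (G s) := by
    intro G hG s hs
    have : ContinuousOn (fun θ : ℝ => G s θ) Set.univ :=
      hG.comp (f := fun θ : ℝ => ((s, θ) : ℝ × ℝ)) (by fun_prop) (fun θ _ => ⟨hs, trivial⟩)
    exact continuousOn_univ.1 this
  obtain ⟨a, ha, ha'⟩ := exists_between hr.1
  obtain ⟨b, hb, hb'⟩ := exists_between hr.2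
  have hsub : Set.Icc a b ⊆ Set.Ioo (-R) R := fun s hs =>
    ⟨lt_of_lt_of_le ha hs.1, lt_of_le_of_lt hs.2 hb'⟩
  have hK : IsCompact (Set.Icc a b ×ˢ Set.Icc (-π) π) := isCompact_Icc.prod isCompact_Icc
  obtain ⟨B, hB⟩ := hK.exists_bound_of_continuousOn
    (hF'.mono (Set.prod_mono hsub (Set.subset_univ _)))
  refine (intervalIntegral.hasDerivAt_integral_of_dominated_loc_of_deriv_le
    (s := Set.Icc a b) (bound := fun _ => B) (Icc_mem_nhds ha' hb) ?_ ?_ ?_ ?_ ?_ ?_).2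
  · filter_upwards [Ioo_mem_nhds hr.1 hr.2] with s hs
    exact (hc F hF s hs).aestronglyMeasurable
  · exact (hc F hF r hr).intervalIntegrable _ _
  · exact (hc F' hF' r hr).aestronglyMeasurable
  · refine Filter.Eventually.of_forall fun t ht s hs => hB (s, t) ⟨hs, ?_⟩
    rw [Set.uIoc_of_le (by linarith [Real.pi_pos])] at ht
    exact ⟨ht.1.le, ht.2⟩
  · exact intervalIntegrable_const
  · exact Filter.Eventually.of_forall fun t ht s hs => hd s (hsub hs) t

lemma lap_eq_circ {W : E2 → ℝ} {y : E2} (h : DifferentiableAt ℝ (fderiv ℝ W) y) (θ : ℝ) :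
    fderiv ℝ (fderiv ℝ W) y (circDir θ) (circDir θ) +
      fderiv ℝ (fderiv ℝ W) y (circDir (θ + π / 2)) (circDir (θ + π / 2)) = lap W y := by
  have h1 : ∀ i : Fin 2, fderiv ℝ (fun z => fderiv ℝ W z (EuclideanSpace.single i 1)) y
      (EuclideanSpace.single i 1) = fderiv ℝ (fderiv ℝ W) y (EuclideanSpace.single i 1)
        (EuclideanSpace.single i 1) := by
    intro i
    have : HasFDerivAt (fun z => fderiv ℝ W z (EuclideanSpace.single i (1:ℝ))) _ y :=
      h.hasFDerivAt.clm_apply (hasFDerivAt_const _ _)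
    rw [this.fderiv]
    simp
  unfold lap
  simp only [h1, Fin.sum_univ_two, circDir_eq, Real.cos_add_pi_div_two, Real.sin_add_pi_div_two, map_add,
    map_smul, add_apply, smul_apply, smul_eq_mul, neg_smul,
    map_neg, neg_apply]
  have := Real.sin_sq_add_cos_sq θ
  linear_combination (fderiv ℝ (fderiv ℝ W) y (EuclideanSpace.single 0 1)
        (EuclideanSpace.single 0 1) + fderiv ℝ (fderiv ℝ W) y (EuclideanSpace.single 1 1)
        (EuclideanSpace.single 1 1)) * this

lemma circ_mem {c : E2} {R r θ : ℝ} (hr : r ∈ Set.Ioo (-R) R) :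
    c + r • circDir θ ∈ ball c R := by
  simp [norm_smul, norm_circDir, abs_lt, hr.1, hr.2]

lemma circ_continuousOn {X : Type*} [TopologicalSpace X] {c : E2} {R : ℝ} {g : E2 → X}
    (hg : ContinuousOn g (ball c R)) :
    ContinuousOn (fun q : ℝ × ℝ => g (c + q.1 • circDir q.2)) (Set.Ioo (-R) R ×ˢ Set.univ) := by
  refine hg.comp (f := fun q : ℝ × ℝ => c + q.1 • circDir q.2) ?_ ?_
  · have := continuous_circDir
    fun_prop
  · intro q hq
    exact circ_mem hq.1

/-- Regularity package for `C²` functions on a ball. -/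
lemma c2_facts {W : E2 → ℝ} {U : Set E2} (hU : IsOpen U) (hW : ContDiffOn ℝ 2 W U) :
    ContinuousOn W U ∧ ContinuousOn (fderiv ℝ W) U ∧ ContinuousOn (fderiv ℝ (fderiv ℝ W)) U ∧
    (∀ y ∈ U, DifferentiableAt ℝ W y) ∧ (∀ y ∈ U, DifferentiableAt ℝ (fderiv ℝ W) y) ∧
    ContinuousOn (lap W) U := by
  have h1 : ContDiffOn ℝ 1 (fderiv ℝ W) U := hW.fderiv_of_isOpen hU (by norm_num)
  have hd : ∀ y ∈ U, DifferentiableAt ℝ (fderiv ℝ W) y := fun y hy =>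
    ((h1.differentiableOn (by norm_num)) y hy).differentiableAt (hU.mem_nhds hy)
  have h2 : ContinuousOn (fderiv ℝ (fderiv ℝ W)) U :=
    h1.continuousOn_fderiv_of_isOpen hU (by norm_num)
  refine ⟨hW.continuousOn, h1.continuousOn, h2,
    fun y hy => ((hW.differentiableOn (by norm_num)) y hy).differentiableAt (hU.mem_nhds hy),
    hd, ?_⟩
  have h3 : ContinuousOn (fun y => fderiv ℝ (fderiv ℝ W) y (circDir 0) (circDir 0) +
      fderiv ℝ (fderiv ℝ W) y (circDir (0 + π / 2)) (circDir (0 + π / 2))) U := by fun_prop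
  exact h3.congr fun y hy => (lap_eq_circ (hd y hy) 0).symm

def cPhi (W : E2 → ℝ) (c : E2) (r : ℝ) : ℝ := ∫ θ in (-π)..π, W (c + r • circDir θ)
def cPsi (W : E2 → ℝ) (c : E2) (r : ℝ) : ℝ :=
  ∫ θ in (-π)..π, fderiv ℝ W (c + r • circDir θ) (circDir θ)

lemma cPhi_deriv {W : E2 → ℝ} {c : E2} {R : ℝ} (hW : ContDiffOn ℝ 2 W (ball c R))
    {r : ℝ} (hr : r ∈ Set.Ioo (-R) R) : HasDerivAt (cPhi W c) (cPsi W c r) r := by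
  obtain ⟨f0, f1, f2, d0, d1, f3⟩ := c2_facts isOpen_ball hW
  refine hasDerivAt_param (fun r θ => W (c + r • circDir θ))
    (fun r θ => fderiv ℝ W (c + r • circDir θ) (circDir θ)) R (circ_continuousOn f0) ?_ ?_ r hr
  · have := circ_continuousOn f1
    have h2 := continuous_circDir
    exact this.clm_apply (by fun_prop)
  · intro s hs θ
    have h1 : HasDerivAt (fun s : ℝ => c + s • circDir θ) (circDir θ) s := by
      simpa using ((hasDerivAt_id s).smul_const (circDir θ)).const_add c
    exact (d0 _ (circ_mem hs)).hasFDerivAt.comp_hasDerivAt s h1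

lemma cPsi_deriv {W : E2 → ℝ} {c : E2} {R : ℝ} (hW : ContDiffOn ℝ 2 W (ball c R))
    {r : ℝ} (hr : r ∈ Set.Ioo (-R) R) :
    HasDerivAt (fun s => s * cPsi W c s) (r * cPhi (lap W) c r) r := by
  obtain ⟨f0, f1, f2, d0, d1, f3⟩ := c2_facts isOpen_ball hW
  have cc := continuous_circDir
  have hvar : ∀ r ∈ Set.Ioo (-R) R, Continuous fun θ : ℝ => r * lap W (c + r • circDir θ) := by
    intro r hr
    refine continuous_const.mul ?_
    refine continuousOn_univ.1 (f3.comp (f := fun θ : ℝ => c + r • circDir θ) (by fun_prop) ?_)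
    exact fun θ _ => circ_mem hr
  have hH : ∀ v w : ℝ → E2, Continuous v → Continuous w →
      ContinuousOn (fun q : ℝ × ℝ => fderiv ℝ (fderiv ℝ W) (c + q.1 • circDir q.2) (v q.2) (w q.2))
        (Set.Ioo (-R) R ×ˢ Set.univ) := by
    intro v w hv hw
    exact ((circ_continuousOn f2).clm_apply (by fun_prop)).clm_apply (by fun_prop)
  have key := hasDerivAt_param (fun r θ => r * fderiv ℝ W (c + r • circDir θ) (circDir θ))
    (fun r θ => fderiv ℝ W (c + r • circDir θ) (circDir θ) +
      r * fderiv ℝ (fderiv ℝ W) (c + r • circDir θ) (circDir θ) (circDir θ)) R ?_ ?_ ?_ r hr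
  · have e1 : (fun s => s * cPsi W c s) =
        fun s => ∫ θ in (-π)..π, s * fderiv ℝ W (c + s • circDir θ) (circDir θ) := by
      ext s
      simp [cPsi]
    rw [e1]
    convert key using 1
    -- periodic part
    have hT : ∀ θ ∈ Set.uIcc (-π) π, HasDerivAt
        (fun θ => fderiv ℝ W (c + r • circDir θ) (circDir (θ + π / 2)))
        (r * lap W (c + r • circDir θ) - (fderiv ℝ W (c + r • circDir θ) (circDir θ) +
      r * fderiv ℝ (fderiv ℝ W) (c + r • circDir θ) (circDir θ) (circDir θ))) θ := by
      intro θ _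
      have h1 : HasDerivAt (fun s : ℝ => c + r • circDir s) (r • circDir (θ + π / 2)) θ :=
        ((hasDerivAt_circDir θ).const_smul r).const_add c
      have h2 := (d1 _ (circ_mem (θ := θ) hr)).hasFDerivAt.comp_hasDerivAt θ h1
      have h3 : HasDerivAt (fun θ => circDir (θ + π / 2)) (-circDir θ) θ := by
        rw [← circDir_add_pi]
        exact (hasDerivAt_circDir (θ + π / 2)).comp_add_const θ (π / 2)
      have h4 := h2.clm_apply h3
      refine h4.congr_deriv ?_
      rw [← lap_eq_circ (d1 _ (circ_mem (θ := θ) hr)) θ]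
      simp
      ring
    have hcont : Continuous fun θ : ℝ => fderiv ℝ W (c + r • circDir θ) (circDir θ) +
        r * fderiv ℝ (fderiv ℝ W) (c + r • circDir θ) (circDir θ) (circDir θ) := by
      have g1 : Continuous fun θ : ℝ => fderiv ℝ W (c + r • circDir θ) :=
        continuousOn_univ.1 (f1.comp (f := fun θ : ℝ => c + r • circDir θ) (by fun_prop)
          fun θ _ => circ_mem hr)
      have g2 : Continuous fun θ : ℝ => fderiv ℝ (fderiv ℝ W) (c + r • circDir θ) :=
        continuousOn_univ.1 (f2.comp (f := fun θ : ℝ => c + r • circDir θ) (by fun_prop)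
          fun θ _ => circ_mem hr)
      exact (g1.clm_apply cc).add (continuous_const.mul ((g2.clm_apply cc).clm_apply cc))
    have hI := intervalIntegral.integral_eq_sub_of_hasDerivAt hT
      (((hvar r hr).sub hcont).intervalIntegrable _ _)
    rw [intervalIntegral.integral_sub ((hvar r hr).intervalIntegrable _ _)
      (hcont.intervalIntegrable _ _)] at hI
    have p1 : circDir (-π) = circDir π := by simp [circDir]
    have p2 : circDir (-π + π / 2) = circDir (π + π / 2) := by
      have : π + π / 2 = (-π + π / 2) + 2 * π := by ring
      rw [this]
      simp only [circDir, Real.cos_add_two_pi, Real.sin_add_two_pi]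
    rw [p1, p2, sub_self] at hI
    rw [cPhi, ← intervalIntegral.integral_const_mul]
    linarith
  · have := (circ_continuousOn f1).clm_apply (g := fun q : ℝ × ℝ => circDir q.2) (by fun_prop)
    exact continuousOn_fst.mul this
  · exact ((circ_continuousOn f1).clm_apply (g := fun q : ℝ × ℝ => circDir q.2) (by fun_prop)).add
      (continuousOn_fst.mul (hH _ _ cc cc))
  · intro s hs θ
    have h1 : HasDerivAt (fun s : ℝ => c + s • circDir θ) (circDir θ) s := by
      simpa using ((hasDerivAt_id s).smul_const (circDir θ)).const_add c
    have h2 : HasDerivAt (fun s : ℝ => fderiv ℝ W (c + s • circDir θ) (circDir θ))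
        (fderiv ℝ (fderiv ℝ W) (c + s • circDir θ) (circDir θ) (circDir θ)) s := by
      have h0 := ((d1 _ (circ_mem (θ := θ) hs)).hasFDerivAt.comp_hasDerivAt s h1)
      have h5 := h0.clm_apply (hasDerivAt_const s (circDir θ))
      refine h5.congr_deriv ?_
      rw [map_zero, add_zero]
    have h3 := (hasDerivAt_id' s).mul h2
    refine h3.congr_deriv ?_
    rw [one_mul]

/-! ### Polar coordinates -/

lemma polar_ball {f : E2 → ℝ} {c : E2} {R r : ℝ} (hf : ContinuousOn f (ball c R))
    (hr0 : 0 ≤ r) (hrR : r < R) :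
    ∫ y in ball c r, f y = ∫ s in (0:ℝ)..r, s * cPhi f c s := by
  let e : E2 ≃ᵐ ℝ × ℝ :=
    (MeasurableEquiv.toLp 2 (Fin 2 → ℝ)).symm.trans MeasurableEquiv.finTwoArrow
  have he : MeasurePreserving e volume volume :=
    (EuclideanSpace.volume_preserving_symm_measurableEquiv_toLp (Fin 2)).trans
      (volume_preserving_finTwoArrow ℝ)
  have hes : MeasurePreserving e.symm volume volume := he.symm
  have h1 : ∫ y in ball c r, f y = ∫ y, (ball (0:E2) r).indicator (fun y => f (c + y)) y := by
    rw [← integral_indicator measurableSet_ball, ← integral_add_left_eq_self _ c]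
    congr 1
    ext y
    simp [Set.indicator]
  rw [h1, ← hes.integral_comp e.symm.measurableEmbedding, ← integral_comp_polarCoord_symm]
  have hT : ∀ q : ℝ × ℝ, e.symm (polarCoord.symm q) = q.1 • circDir q.2 := by
    intro q
    ext i
    fin_cases i <;> simp [e, circDir, polarCoord, MeasurableEquiv.finTwoArrow]
  have h2 : ∫ q in polarCoord.target, q.1 • (ball (0:E2) r).indicator (fun y => f (c + y))
      (e.symm (polarCoord.symm q)) = ∫ q in Set.Ioo 0 r ×ˢ Set.Ioo (-π) π,
        q.1 * f (c + q.1 • circDir q.2) := by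
    have hsub : Set.Ioo 0 r ×ˢ Set.Ioo (-π) π ⊆ polarCoord.target := by
      rintro ⟨a, b⟩ ⟨h, h'⟩
      exact ⟨h.1, h'⟩
    have hms : MeasurableSet (Set.Ioo 0 r ×ˢ Set.Ioo (-π) π) :=
      measurableSet_Ioo.prod measurableSet_Ioo
    rw [← Set.inter_eq_right.2 hsub, ← setIntegral_indicator hms]
    refine setIntegral_congr_fun polarCoord.open_target.measurableSet fun q hq => ?_
    simp only [hT]
    have hq1 : 0 < q.1 := hq.1
    by_cases h : q.1 < r
    · rw [Set.indicator_of_mem, Set.indicator_of_mem, smul_eq_mul]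
      · exact ⟨⟨hq1, h⟩, hq.2⟩
      · simpa [norm_smul, norm_circDir, abs_of_pos hq1] using h
    · rw [Set.indicator_of_notMem, Set.indicator_of_notMem, smul_zero]
      · exact fun h' => h h'.1.2
      · simpa [norm_smul, norm_circDir, abs_of_pos hq1] using h
  rw [h2]
  have hcont : ContinuousOn (fun q : ℝ × ℝ => q.1 * f (c + q.1 • circDir q.2))
      (Set.Icc 0 r ×ˢ Set.Icc (-π) π) :=
    (continuousOn_fst.mul (circ_continuousOn hf)).mono (by
      rintro ⟨a, b⟩ ⟨h, h'⟩
      exact ⟨⟨by linarith [h.1], by linarith [h.2]⟩, trivial⟩)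
  have hint : IntegrableOn (fun q : ℝ × ℝ => q.1 * f (c + q.1 • circDir q.2))
      (Set.Ioo 0 r ×ˢ Set.Ioo (-π) π) (volume.prod volume) :=
    (hcont.integrableOn_compact (isCompact_Icc.prod isCompact_Icc)).mono_set
      (Set.prod_mono Set.Ioo_subset_Icc_self Set.Ioo_subset_Icc_self)
  rw [Measure.volume_eq_prod, setIntegral_prod _ hint, intervalIntegral.integral_of_le hr0,
    integral_Ioc_eq_integral_Ioo]
  refine setIntegral_congr_fun measurableSet_Ioo fun s _ => ?_
  simp only [cPhi]
  rw [intervalIntegral.integral_of_le (by linarith [Real.pi_pos]), integral_Ioc_eq_integral_Ioo,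
    integral_const_mul]

lemma cPhi_zero (W : E2 → ℝ) (c : E2) : cPhi W c 0 = 2 * π * W c := by
  simp only [cPhi, zero_smul, add_zero, intervalIntegral.integral_const, smul_eq_mul]
  ring

lemma cPhi_continuousOn {W : E2 → ℝ} {c : E2} {R : ℝ} (hW : ContDiffOn ℝ 2 W (ball c R)) :
    ContinuousOn (cPhi W c) (Set.Ioo (-R) R) :=
  fun _ hs => (cPhi_deriv hW hs).continuousAt.continuousWithinAt

lemma cPhi_nonneg {f : E2 → ℝ} {c : E2} {R r : ℝ} (hf : ∀ y ∈ ball c R, 0 ≤ f y)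
    (hr : r ∈ Set.Ioo (-R) R) : 0 ≤ cPhi f c r :=
  intervalIntegral.integral_nonneg (by linarith [Real.pi_pos]) fun _ _ => hf _ (circ_mem hr)

lemma cPhi_le {f : E2 → ℝ} {c : E2} {R r A : ℝ} (hc : ContinuousOn f (ball c R))
    (hf : ∀ y ∈ ball c R, f y ≤ A)
    (hr : r ∈ Set.Ioo (-R) R) : cPhi f c r ≤ 2 * π * A := by
  have h : cPhi f c r ≤ ∫ θ in (-π)..π, A := by
    refine intervalIntegral.integral_mono_on (by linarith [Real.pi_pos]) ?_ (by simp)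
      fun _ _ => hf _ (circ_mem hr)
    apply Continuous.intervalIntegrable
    have := continuous_circDir
    exact continuousOn_univ.1 (hc.comp (f := fun θ : ℝ => c + r • circDir θ) (by fun_prop)
          fun θ _ => circ_mem hr)
  refine h.trans (le_of_eq ?_)
  rw [intervalIntegral.integral_const, smul_eq_mul]
  ring

/-- comparison of derivatives on `[0,R)` -/
lemma le_of_deriv_le {g h g' h' : ℝ → ℝ} {R : ℝ}
    (hg : ∀ s ∈ Set.Ico 0 R, HasDerivAt g (g' s) s) (hh : ∀ s ∈ Set.Ico 0 R, HasDerivAt h (h' s) s)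
    (h0 : g 0 ≤ h 0) (hle : ∀ s ∈ Set.Ioo 0 R, g' s ≤ h' s) {r : ℝ} (hr : r ∈ Set.Ico 0 R) :
    g r ≤ h r := by
  have hm : MonotoneOn (fun s => h s - g s) (Set.Ico 0 R) := by
    refine monotoneOn_of_deriv_nonneg (convex_Ico 0 R) ?_ ?_ ?_
    · exact fun s hs => ((hh s hs).sub (hg s hs)).continuousAt.continuousWithinAt
    · intro s hs
      have hs' := interior_subset hs
      exact ((hh s hs').sub (hg s hs')).differentiableAt.differentiableWithinAt
    · intro s hs
      have hs' := interior_subset hs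
      rw [interior_Ico] at hs
      have := ((hh s hs').sub (hg s hs')).deriv
      have h5 := hle s hs
      change 0 ≤ deriv (h - g) s
      rw [this]
      linarith
  have := hm ⟨le_rfl, lt_of_le_of_lt hr.1 hr.2⟩ hr hr.1
  simp only at this
  linarith

lemma mem_Ioo_of_Ico {R s : ℝ} (hs : s ∈ Set.Ico 0 R) : s ∈ Set.Ioo (-R) R :=
  ⟨by linarith [hs.1, hs.2], hs.2⟩

lemma mul_cPsi_nonneg {W : E2 → ℝ} {c : E2} {R r : ℝ} (hW : ContDiffOn ℝ 2 W (ball c R))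
    (hl : ∀ y ∈ ball c R, 0 ≤ lap W y) (hr : r ∈ Set.Ico 0 R) : 0 ≤ r * cPsi W c r :=
  le_of_deriv_le (g := fun _ => 0) (g' := fun _ => 0) (h := fun s => s * cPsi W c s)
    (fun s _ => hasDerivAt_const s 0)
    (fun s hs => cPsi_deriv hW (mem_Ioo_of_Ico hs)) (by simp)
    (fun s hs => mul_nonneg hs.1.le (cPhi_nonneg hl (mem_Ioo_of_Ico ⟨hs.1.le, hs.2⟩))) hr

lemma mean_value_le {W : E2 → ℝ} {c : E2} {R r : ℝ} (hW : ContDiffOn ℝ 2 W (ball c R))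
    (hl : ∀ y ∈ ball c R, 0 ≤ lap W y) (hr : r ∈ Set.Ico 0 R) :
    2 * π * W c ≤ cPhi W c r := by
  refine le_of_deriv_le (g := fun _ => 2 * π * W c) (g' := fun _ => 0) (h := cPhi W c)
    (fun s _ => hasDerivAt_const s _)
    (fun s hs => cPhi_deriv hW (mem_Ioo_of_Ico hs)) (by rw [cPhi_zero]) ?_ hr
  intro s hs
  have := mul_cPsi_nonneg hW hl ⟨hs.1.le, hs.2⟩
  exact nonneg_of_mul_nonneg_right this hs.1

lemma cPhi_int {W : E2 → ℝ} {c : E2} {R r : ℝ} (hW : ContDiffOn ℝ 2 W (ball c R))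
    (hr : r ∈ Set.Ico 0 R) : IntervalIntegrable (fun s => s * cPhi W c s) volume 0 r := by
  refine ContinuousOn.intervalIntegrable ?_
  rw [Set.uIcc_of_le hr.1]
  refine continuousOn_id.mul ((cPhi_continuousOn hW).mono ?_)
  exact fun s hs => mem_Ioo_of_Ico ⟨hs.1, hs.2.trans_lt hr.2⟩

lemma mean_value_ball {W : E2 → ℝ} {c : E2} {R r : ℝ} (hW : ContDiffOn ℝ 2 W (ball c R))
    (hl : ∀ y ∈ ball c R, 0 ≤ lap W y) (hr : r ∈ Set.Ico 0 R) :
    π * r ^ 2 * W c ≤ ∫ y in ball c r, W y := by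
  rw [polar_ball hW.continuousOn hr.1 hr.2]
  have h : ∫ s in (0:ℝ)..r, s * (2 * π * W c) ≤ ∫ s in (0:ℝ)..r, s * cPhi W c s := by
    refine intervalIntegral.integral_mono_on hr.1 ?_ (cPhi_int hW hr) ?_
    · exact (by fun_prop : Continuous fun s : ℝ => s * (2 * π * W c)).intervalIntegrable _ _
    · intro s hs
      exact mul_le_mul_of_nonneg_left (mean_value_le hW hl ⟨hs.1, hs.2.trans_lt hr.2⟩) hs.1
  refine le_trans (le_of_eq ?_) h
  rw [intervalIntegral.integral_mul_const, integral_id]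
  ring

/-- Logarithmic growth of circle means. -/
lemma cPhi_log {W : E2 → ℝ} {c : E2} {R r A κ ε : ℝ} (hW : ContDiffOn ℝ 2 W (ball c R))
    (hl : ∀ y ∈ ball c R, 0 ≤ lap W y) (hA : ∀ y ∈ ball c R, lap W y ≤ A)
    (hκ : ∀ t ∈ Set.Ico 0 R, ∫ y in ball c t, lap W y ≤ κ) (hε : 0 < ε) (hWc : W c = 0)
    (hr : r ∈ Set.Ico 0 R) :
    cPhi W c r ≤ (π * A * ε ^ 2 + 2 * κ) * Real.log (1 + r / ε) := by
  obtain ⟨f0, f1, f2, d0, d1, f3⟩ := c2_facts isOpen_ball hW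
  have hR : 0 < R := hr.1.trans_lt hr.2
  have hA0 : 0 ≤ A := (hl c (mem_ball_self hR)).trans (hA c (mem_ball_self hR))
  have b1 : ∀ s ∈ Set.Ico 0 R, s * cPsi W c s ≤ π * A * s ^ 2 := by
    intro s hs
    refine le_of_deriv_le (g := fun s => s * cPsi W c s) (h := fun s => π * A * s ^ 2)
      (h' := fun s => π * A * (2 * s))
      (fun s hs => cPsi_deriv hW (mem_Ioo_of_Ico hs)) ?_ (by simp) ?_ hs
    · intro s _
      simpa using (hasDerivAt_pow 2 s).const_mul (π * A)
    · intro s hs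
      have := cPhi_le f3 hA (mem_Ioo_of_Ico ⟨hs.1.le, hs.2⟩)
      have := mul_le_mul_of_nonneg_left this hs.1.le
      linarith
  have b2 : ∀ s ∈ Set.Ico 0 R, s * cPsi W c s ≤ κ := by
    intro s hs
    have h1 : ∀ t ∈ Set.uIcc 0 s, HasDerivAt (fun s => s * cPsi W c s) (t * cPhi (lap W) c t) t := by
      intro t ht
      rw [Set.uIcc_of_le hs.1] at ht
      exact cPsi_deriv hW (mem_Ioo_of_Ico ⟨ht.1, ht.2.trans_lt hs.2⟩)
    have h2 : IntervalIntegrable (fun t => t * cPhi (lap W) c t) volume 0 s := by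
      refine intervalIntegral.intervalIntegrable_deriv_of_nonneg (g := fun s => s * cPsi W c s)
        (fun t ht => (h1 t ht).continuousAt.continuousWithinAt) ?_ ?_
      · intro t ht
        exact h1 t (Set.Ioo_subset_Icc_self ht)
      · intro t ht
        rw [min_eq_left hs.1, max_eq_right hs.1] at ht
        exact mul_nonneg ht.1.le (cPhi_nonneg hl (mem_Ioo_of_Ico ⟨ht.1.le, ht.2.trans hs.2⟩))
    have h3 := intervalIntegral.integral_eq_sub_of_hasDerivAt h1 h2
    rw [← polar_ball f3 hs.1 hs.2] at h3
    have := hκ s hs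
    simp at h3
    linarith
  have hκ0 : 0 ≤ κ := by simpa using hκ 0 ⟨le_rfl, hR⟩
  refine le_of_deriv_le (g := cPhi W c) (h := fun s => (π * A * ε ^ 2 + 2 * κ) *
    Real.log (1 + s / ε)) (h' := fun s => (π * A * ε ^ 2 + 2 * κ) * ((1 / ε) / (1 + s / ε)))
    (fun s hs => cPhi_deriv hW (mem_Ioo_of_Ico hs)) ?_ (by simp [cPhi_zero, hWc]) ?_ hr
  · intro s hs
    have hpos : 0 < 1 + s / ε := by have := hs.1; positivity
    exact ((((hasDerivAt_id s).div_const ε).const_add 1).log hpos.ne').const_mul _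
  · intro s hs
    have hs' : s ∈ Set.Ico 0 R := ⟨hs.1.le, hs.2⟩
    have e1 : (1 / ε) / (1 + s / ε) = 1 / (ε + s) := by
      field_simp
    have hs0 := hs.1
    rw [e1, mul_one_div, le_div_iff₀ (by positivity)]
    have c1 := b1 s hs'
    have c2 := b2 s hs'
    have c0 : 0 ≤ cPsi W c s := nonneg_of_mul_nonneg_right (mul_cPsi_nonneg hW hl hs') hs0
    have hpA : 0 ≤ π * A := by positivity
    have : cPsi W c s * ε ≤ π * A * ε ^ 2 + κ := by
      rcases le_total s ε with h | h
      · have : cPsi W c s ≤ π * A * s := by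
          refine le_of_mul_le_mul_left ?_ hs0
          linarith
        nlinarith [mul_le_mul_of_nonneg_right this hε.le, mul_le_mul_of_nonneg_left h hpA,
          mul_le_mul_of_nonneg_right (mul_le_mul_of_nonneg_left h hpA) hε.le]
      · nlinarith [mul_le_mul_of_nonneg_left h c0, mul_nonneg hpA (sq_nonneg ε)]
    nlinarith

lemma W_log {W : E2 → ℝ} {c z : E2} {R A κ ε : ℝ} (hW : ContDiffOn ℝ 2 W (ball c R))
    (hl : ∀ y ∈ ball c R, 0 ≤ lap W y) (hA : ∀ y ∈ ball c R, lap W y ≤ A)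
    (hκ : ∀ t ∈ Set.Ico 0 R, ∫ y in ball c t, lap W y ≤ κ) (hε : 0 < ε) (hWc : W c = 0)
    (hW0 : ∀ y ∈ ball c R, 0 ≤ W y) (hz : 3 / 2 * ‖z - c‖ < R) :
    W z ≤ 9 / π * (π * A * ε ^ 2 + 2 * κ) * Real.log (2 + ‖z - c‖ / ε) := by
  have hR : 0 < R := lt_of_le_of_lt (by positivity) hz
  have hA0 : 0 ≤ A := (hl c (mem_ball_self hR)).trans (hA c (mem_ball_self hR))
  have hκ0 : 0 ≤ κ := by simpa using hκ 0 ⟨le_rfl, hR⟩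
  have hpi := Real.pi_pos
  set d := ‖z - c‖ with hd
  have hd0 : 0 ≤ d := norm_nonneg _
  set B := π * A * ε ^ 2 + 2 * κ with hB
  have hB0 : 0 ≤ B := by positivity
  rcases hd0.eq_or_lt with h0 | hdpos
  · have : z = c := by rw [← sub_eq_zero, ← norm_eq_zero]; exact h0.symm
    rw [this, hWc]
    have : 0 ≤ Real.log (2 + d / ε) := Real.log_nonneg (by have : 0 ≤ d / ε := by positivity
                                                           linarith)
    positivity
  have hsub : ball z (d / 2) ⊆ ball c (3 / 2 * d) := by
    apply ball_subset_ball'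
    rw [dist_eq_norm, ← hd]
    linarith
  -- a slightly larger ball is not needed: choose any radius between
  obtain ⟨R', hR1, hR2⟩ := exists_between hz
  have hsub' : ball z (R' - d) ⊆ ball c R := by
    apply ball_subset_ball'
    rw [dist_eq_norm, ← hd]
    linarith
  have m1 := mean_value_ball (hW.mono hsub') (fun y hy => hl y (hsub' hy))
    (r := d / 2) ⟨by positivity, by linarith⟩
  have hmem : 3 / 2 * d ∈ Set.Ico 0 R := ⟨by positivity, hz⟩
  have m2 : ∫ y in ball z (d / 2), W y ≤ ∫ y in ball c (3 / 2 * d), W y := by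
    refine setIntegral_mono_set ?_ ?_ hsub.eventuallyLE
    · have : ContinuousOn W (closedBall c (3 / 2 * d)) :=
        hW.continuousOn.mono (closedBall_subset_ball hz)
      exact (this.integrableOn_compact (isCompact_closedBall _ _)).mono_set ball_subset_closedBall
    · exact (ae_restrict_iff' measurableSet_ball).2 (Filter.Eventually.of_forall fun y hy =>
        hW0 y (ball_subset_ball hz.le hy))
  rw [polar_ball hW.continuousOn hmem.1 hmem.2] at m2
  set Lg := Real.log (1 + 3 / 2 * d / ε) with hLg
  have m3 : ∫ s in (0:ℝ)..(3 / 2 * d), s * cPhi W c s ≤ ∫ s in (0:ℝ)..(3 / 2 * d), s * (B * Lg) := by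
    refine intervalIntegral.integral_mono_on hmem.1 (cPhi_int hW hmem) ?_ ?_
    · exact (by fun_prop : Continuous fun s : ℝ => s * (B * Lg)).intervalIntegrable _ _
    · intro s hs
      refine mul_le_mul_of_nonneg_left ?_ hs.1
      have hs' : s ∈ Set.Ico 0 R := ⟨hs.1, hs.2.trans_lt hz⟩
      refine (cPhi_log hW hl hA hκ hε hWc hs').trans ?_
      refine mul_le_mul_of_nonneg_left ?_ hB0
      have h0 := hs.1
      apply Real.log_le_log (by positivity)
      have := div_le_div_of_nonneg_right hs.2 hε.le
      linarith
  rw [intervalIntegral.integral_mul_const, integral_id] at m3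
  have hlog : Lg ≤ 2 * Real.log (2 + d / ε) := by
    have ht : 0 ≤ d / ε := by positivity
    rw [← Real.log_rpow (by positivity)]
    apply Real.log_le_log (by positivity)
    have : 3 / 2 * d / ε = 3 / 2 * (d / ε) := by ring
    rw [this]
    norm_num
    nlinarith
  have m4 : π * (d / 2) ^ 2 * W z ≤ ((3 / 2 * d) ^ 2 / 2) * (B * Lg) := by
    refine (m1.trans (m2.trans m3)).trans (le_of_eq ?_)
    ring
  have m5 : W z ≤ 9 / (2 * π) * (B * Lg) := by
    have hd2 : 0 < π * (d / 2) ^ 2 := by positivity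
    refine le_of_mul_le_mul_left ?_ hd2
    refine m4.trans (le_of_eq ?_)
    field_simp
    try ring
  refine m5.trans ?_
  have : 9 / (2 * π) * (B * Lg) ≤ 9 / (2 * π) * (B * (2 * Real.log (2 + d / ε))) := by gcongr
  refine this.trans (le_of_eq ?_)
  field_simp

/-! ### Lower bound for the maximum -/

lemma deriv2_nonpos {g g' : ℝ → ℝ} {d : ℝ} (hmax : IsLocalMax g 0)
    (hg : ∀ᶠ t in 𝓝 0, HasDerivAt g (g' t) t) (hg' : HasDerivAt g' d 0) : d ≤ 0 := by
  by_contra hd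
  push Not at hd
  have e : deriv g =ᶠ[𝓝 0] g' := hg.mono fun t ht => ht.deriv
  have e2 : deriv (deriv g) 0 = d := by rw [e.deriv_eq, hg'.deriv]
  have hmin : IsLocalMin g 0 := isLocalMin_of_deriv_deriv_pos (by rw [e2]; exact hd)
    hmax.deriv_eq_zero hg.self_of_nhds.continuousAt
  have hc : g =ᶠ[𝓝 0] fun _ => g 0 := by
    filter_upwards [hmax, hmin] with t h1 h2
    exact le_antisymm h1 h2
  have : deriv (deriv g) 0 = 0 := by
    rw [hc.deriv.deriv_eq]
    simp
  linarith

lemma lap_le_of_localMax {u : E2 → ℝ} {Ω : Set E2} (hΩ : IsOpen Ω) (hu : ContDiffOn ℝ 2 u Ω)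
    {y : E2} (hy : y ∈ Ω) (K : ℝ) (hmax : IsLocalMax (fun x => u x + K * ‖x‖ ^ 2) y) :
    lap u y + 4 * K ≤ 0 := by
  obtain ⟨f0, f1, f2, d0, d1, f3⟩ := c2_facts hΩ hu
  have key : ∀ i : Fin 2, fderiv ℝ (fun y => fderiv ℝ u y (EuclideanSpace.single i 1)) y
      (EuclideanSpace.single i 1) + 2 * K ≤ 0 := by
    intro i
    set e : E2 := EuclideanSpace.single i 1 with he
    have hen : ‖e‖ = 1 := by simp [he]
    set a : ℝ := inner ℝ y e with ha
    have hl : ∀ t : ℝ, HasDerivAt (fun s : ℝ => y + s • e) e t := fun t => by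
      simpa using ((hasDerivAt_id t).smul_const e).const_add y
    have hcont : ContinuousAt (fun s : ℝ => y + s • e) 0 := (hl 0).continuousAt
    have h0 : y + (0:ℝ) • e = y := by simp
    have hev : ∀ᶠ t in 𝓝 (0:ℝ), y + t • e ∈ Ω :=
      hcont.eventually_mem (by rw [h0]; exact hΩ.mem_nhds hy)
    refine deriv2_nonpos (g := fun t => u (y + t • e) + K * (‖y‖ ^ 2 + 2 * t * a + t ^ 2))
      (g' := fun t => fderiv ℝ u (y + t • e) e + K * (2 * a + 2 * t)) ?_ ?_ ?_
    · have h2 : IsLocalMax ((fun x => u x + K * ‖x‖ ^ 2) ∘ fun s : ℝ => y + s • e) 0 := by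
        refine IsMaxFilter.comp_tendsto (l := 𝓝 y) ?_ ?_
        · rw [h0]; exact hmax
        · simpa using hcont.tendsto
      have h3 : ((fun x => u x + K * ‖x‖ ^ 2) ∘ fun s : ℝ => y + s • e) =
          fun t => u (y + t • e) + K * (‖y‖ ^ 2 + 2 * t * a + t ^ 2) := by
        ext t
        simp only [Function.comp, norm_add_sq_real, inner_smul_right, norm_smul, hen, mul_one,
          Real.norm_eq_abs, sq_abs, ← ha]
        ring
      rwa [h3] at h2
    · filter_upwards [hev] with t ht
      have h1 := (d0 _ ht).hasFDerivAt.comp_hasDerivAt t (hl t)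
      have h2 : HasDerivAt (fun t : ℝ => K * (‖y‖ ^ 2 + 2 * t * a + t ^ 2))
          (K * (2 * a + 2 * t)) t := by
        have h3 := (((((hasDerivAt_id t).const_mul 2).mul_const a).const_add (‖y‖ ^ 2)).add
          (hasDerivAt_pow 2 t)).const_mul K
        refine h3.congr_deriv ?_
        simp
      exact h1.add h2
    · have hd : DifferentiableAt ℝ (fun z => fderiv ℝ u z e) y :=
        (d1 y hy).clm_apply (differentiableAt_const _)
      have h1 : HasDerivAt (fun t : ℝ => fderiv ℝ u (y + t • e) e)
          (fderiv ℝ (fun z => fderiv ℝ u z e) y e) 0 := by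
        refine HasFDerivAt.comp_hasDerivAt (l := fun z => fderiv ℝ u z e) (0:ℝ) ?_ (hl 0)
        rw [h0]
        exact hd.hasFDerivAt
      have h2 : HasDerivAt (fun t : ℝ => K * (2 * a + 2 * t)) (2 * K) 0 := by
        refine ((((hasDerivAt_id (0:ℝ)).const_mul 2).const_add (2 * a)).const_mul K).congr_deriv ?_
        ring
      exact h1.add h2
  have k0 := key 0
  have k1 := key 1
  unfold lap
  rw [Fin.sum_univ_two]
  linarith

lemma nonlin_le {p a M : ℝ} (hp : 1 < p) (ha : a ≤ M) (hM : 0 < M) :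
    |a| ^ (p - 1) * a ≤ M ^ (p - 1) * M := by
  rcases le_total a 0 with h | h
  · exact (mul_nonpos_of_nonneg_of_nonpos (by positivity) h).trans (by positivity)
  · rw [abs_of_nonneg h]
    exact mul_le_mul (Real.rpow_le_rpow h ha (by linarith)) ha h (by positivity)

lemma max_lower {Ω : Set E2} (hΩo : IsOpen Ω) {Rb : ℝ} (hΩb : closure Ω ⊆ closedBall 0 Rb)
    {p : ℝ} (hp : 1 < p) {u : E2 → ℝ} (hs : IsSolution Ω p u) {c : E2} (hc : c ∈ Ω)
    (hmax : ∀ y ∈ closure Ω, u y ≤ u c) (hpos : 0 < u c) : 1 ≤ (u c) ^ (p - 1) * Rb ^ 2 := by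
  obtain ⟨h1, h2, h3, h4⟩ := hs
  set M := u c
  set K := M ^ (p - 1) * M / 2 with hK
  have hKpos : 0 < K := by positivity
  have hcomp : IsCompact (closure Ω) := (isCompact_closedBall (0:E2) Rb).of_isClosed_subset
    isClosed_closure hΩb
  obtain ⟨y, hy, hym⟩ := hcomp.exists_isMaxOn ⟨c, subset_closure hc⟩
    (f := fun x => u x + K * ‖x‖ ^ 2) (by fun_prop)
  have hyR : ‖y‖ ≤ Rb := by simpa using hΩb hy
  by_cases hyΩ : y ∈ Ω
  · exfalso
    have hloc : IsLocalMax (fun x => u x + K * ‖x‖ ^ 2) y :=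
      hym.isLocalMax (Filter.mem_of_superset (hΩo.mem_nhds hyΩ) subset_closure)
    have := lap_le_of_localMax hΩo h1 hyΩ K hloc
    have h5 := h3 y hyΩ
    have h6 := nonlin_le hp (hmax y hy) hpos
    have h7 : 0 < M ^ (p - 1) * M := by positivity
    change _ ≤ M ^ (p - 1) * M at h6
    linarith
  · have hf : y ∈ frontier Ω := by
      rw [hΩo.frontier_eq]
      exact ⟨hy, hyΩ⟩
    have h5 := hym (subset_closure hc)
    simp only [Set.mem_ofPred_eq, h4 y hf, zero_add] at h5
    have h6 : ‖y‖ ^ 2 ≤ Rb ^ 2 := by gcongr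
    have h7 : M ≤ M * (M ^ (p - 1) * Rb ^ 2 / 2) := by
      have : K * ‖y‖ ^ 2 ≤ K * Rb ^ 2 := by gcongr
      have h8 : 0 ≤ K * ‖c‖ ^ 2 := by positivity
      have h9 : u c = M := rfl
      rw [h9] at h5
      calc M ≤ K * Rb ^ 2 := by linarith
        _ = _ := by rw [hK]; ring
    have h8 : 1 ≤ M ^ (p - 1) * Rb ^ 2 / 2 := by
      by_contra h
      push Not at h
      nlinarith
    linarith

lemma lap_neg' (u : E2 → ℝ) (y : E2) : lap (fun x => -u x) y = -lap u y := by
  unfold lap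
  rw [← Finset.sum_neg_distrib]
  refine Finset.sum_congr rfl fun i _ => ?_
  have : (fun y => fderiv ℝ (fun x => -u x) y (EuclideanSpace.single i (1:ℝ))) =
      fun y => -(fderiv ℝ u y (EuclideanSpace.single i 1)) := by
    ext z
    rw [fderiv_fun_neg]
    rfl
  rw [this, fderiv_fun_neg]
  rfl

lemma lap_const_sub (u : E2 → ℝ) (M : ℝ) (y : E2) : lap (fun x => M - u x) y = -lap u y := by
  rw [← lap_neg']
  unfold lap
  simp only [fderiv_const_sub, fderiv_fun_neg]

lemma isSolution_neg {Ω : Set E2} {p : ℝ} {u : E2 → ℝ} (h : IsSolution Ω p u) :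
    IsSolution Ω p (fun x => -u x) := by
  obtain ⟨h1, h2, h3, h4⟩ := h
  refine ⟨h1.neg, h2.neg, fun x hx => ?_, fun x hx => by simp [h4 x hx]⟩
  rw [lap_neg', abs_neg, h3 x hx |> neg_eq_iff_eq_neg.1]
  ring

lemma bernoulli_base_two {p : ℝ} (hp : 1 ≤ p) : 1 + p ≤ (2:ℝ) ^ p := by
  have := one_add_mul_self_le_rpow_one_add (s := 1) (by norm_num) hp
  norm_num at this
  linarith

lemma one_sided
    (Ω : Set E2) (hΩo : IsOpen Ω) (hΩb : IsBounded Ω)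
    (p : ℕ → ℝ) (hp1 : ∀ n, 1 < p n) (hptop : Tendsto p atTop atTop)
    (u : ℕ → E2 → ℝ)
    (hsol : ∀ n, IsSolution Ω (p n) (u n))
    (hlow : Tendsto (fun n => p n * ∫ x in Ω, |u n x| ^ (p n + 1)) atTop
      (𝓝 (16 * π * Real.exp 1)))
    (c : ℕ → E2)
    (hmax : ∀ n, c n ∈ Ω ∧ ∀ y ∈ closure Ω, u n y ≤ u n (c n))
    (hpos : ∀ n, 0 < u n (c n))
    (x : E2) (hx : x ∈ Ω)
    (hxconv : Tendsto c atTop (𝓝 x))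
    (ε : ℕ → ℝ) (hεpos : ∀ n, 0 < ε n)
    (hεdef : ∀ n, (ε n) ^ 2 * (p n * |u n (c n)| ^ (p n - 1)) = 1)
    (ϱ0 : ℝ) (hϱ0 : 0 < ϱ0) (N0 : ℕ)
    (hsign : ∀ n ≥ N0, (∀ y ∈ ball x (2 * ϱ0), 1 / p n ≤ u n y)) :
    ∃ C > (0:ℝ), ∃ N : ℕ, ∀ n ≥ N, ∀ z : E2,
      ‖z‖ ≤ ϱ0 / ε n → |(p n / u n (c n)) * (u n (c n + ε n • z) - u n (c n))| ≤
        C * Real.log (2 + ‖z‖) := by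
  have hpi := Real.pi_pos
  obtain ⟨Rb, hRb⟩ := hΩb.closure.subset_closedBall (0:E2)
  have hcomp : IsCompact (closure Ω) := hΩb.isCompact_closure
  set K : ℝ := 2 * (16 * π * Real.exp 1 + 1) + volume.real Ω with hK
  have hKpos : 0 < K := by positivity
  refine ⟨9 / π * (π + 4 * K), by positivity, ?_⟩
  have ev1 : ∀ᶠ n in atTop, p n * ∫ x in Ω, |u n x| ^ (p n + 1) < 16 * π * Real.exp 1 + 1 :=
    hlow.eventually_lt_const (by linarith)
  have ev2 : ∀ᶠ n in atTop, dist (c n) x < ϱ0 / 4 :=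
    hxconv.eventually (ball_mem_nhds x (by positivity))
  have ev3 : ∀ᶠ n in atTop, max (Rb ^ 2) 2 < p n := hptop.eventually_gt_atTop _
  obtain ⟨N, hN⟩ := eventually_atTop.1 (ev1.and (ev2.and (ev3.and (eventually_ge_atTop N0))))
  refine ⟨N, fun n hn z hz => ?_⟩
  obtain ⟨e1, e2, e3, e4⟩ := hN n hn
  have hs4 := hsign n e4
  have hp := hp1 n
  have hsn := hsol n
  have hM := hpos n
  have hml := max_lower hΩo hRb hp hsn (hmax n).1 (hmax n).2 hM
  obtain ⟨s1, s2, s3, s4⟩ := hsol n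
  have hεn := hεpos n
  have hεd := hεdef n
  obtain ⟨hcΩ, hcm⟩ := hmax n
  rw [abs_of_pos hM] at hεd
  set P := p n with hP
  set U := u n with hU
  set ep := ε n with hep
  set cn := c n with hcn
  set M := U cn with hMdef
  have hP0 : 0 < P := by linarith
  have hPR : Rb ^ 2 < P := (le_max_left _ _).trans_lt e3
  have hP2 : 2 < P := (le_max_right _ _).trans_lt e3
  -- the ball is inside the domain
  have hball : ball x (2 * ϱ0) ⊆ Ω := by
    refine (convex_ball x (2 * ϱ0)).isPreconnected.subset_of_closure_inter_subset hΩo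
      ⟨x, mem_ball_self (by positivity), hx⟩ ?_
    rintro y ⟨hy1, hy2⟩
    by_contra hy3
    have : y ∈ frontier Ω := by
      rw [hΩo.frontier_eq]; exact ⟨hy1, hy3⟩
    have h5 := hs4 y hy2
    rw [s4 y this] at h5
    have : 0 < 1 / P := by positivity
    linarith
  have hball2 : ball cn (7 / 4 * ϱ0) ⊆ ball x (2 * ϱ0) := by
    apply ball_subset_ball'
    linarith
  have hballΩ := hball2.trans hball
  -- M ≥ 1/2
  have hMhalf : 1 / 2 ≤ M := by
    by_contra h
    push Not at h
    have h1 : M ^ (P - 1) ≤ (1 / 2 : ℝ) ^ (P - 1) :=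
      Real.rpow_le_rpow hM.le h.le (by linarith)
    have h2 := bernoulli_base_two (p := P - 1) (by linarith)
    have h3 : (1 / 2 : ℝ) ^ (P - 1) ≤ 1 / P := by
      rw [Real.div_rpow (by norm_num) (by norm_num), Real.one_rpow]
      apply one_div_le_one_div_of_le hP0
      linarith
    have h4 : M ^ (P - 1) * Rb ^ 2 ≤ 1 / P * Rb ^ 2 :=
      mul_le_mul_of_nonneg_right (h1.trans h3) (sq_nonneg _)
    have h5 : 1 / P * Rb ^ 2 < 1 := by
      rw [one_div_mul_eq_div, div_lt_one hP0]
      exact hPR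
    linarith
  -- the function W
  have hlap : ∀ y ∈ ball cn (7 / 4 * ϱ0), lap (fun x => M - U x) y = |U y| ^ (P - 1) * U y := by
    intro y hy
    rw [lap_const_sub, s3 y (hballΩ hy)]
  have hUpos : ∀ y ∈ ball cn (7 / 4 * ϱ0), 0 ≤ U y := fun y hy =>
    (by positivity : (0:ℝ) ≤ 1 / P).trans (hs4 y (hball2 hy))
  have hint : IntegrableOn (fun y => 2 * |U y| ^ (P + 1) + (1 / 2 : ℝ) ^ P) Ω := by
    have : ContinuousOn (fun y => 2 * |U y| ^ (P + 1) + (1 / 2 : ℝ) ^ P) (closure Ω) := by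
      refine ContinuousOn.add (continuousOn_const.mul ?_) continuousOn_const
      exact s2.abs.rpow_const fun y _ => Or.inr (by linarith)
    exact (this.integrableOn_compact hcomp).mono_set subset_closure
  have hint1 : IntegrableOn (fun y => |U y| ^ (P + 1)) Ω := by
    have : ContinuousOn (fun y => |U y| ^ (P + 1)) (closure Ω) :=
      s2.abs.rpow_const fun y _ => Or.inr (by linarith)
    exact (this.integrableOn_compact hcomp).mono_set subset_closure
  have hpt : ∀ y, 0 ≤ U y → |U y| ^ (P - 1) * U y ≤ 2 * |U y| ^ (P + 1) + (1 / 2 : ℝ) ^ P := by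
    intro y hy
    rw [abs_of_nonneg hy]
    have hq : U y ^ (P - 1) * U y = U y ^ P := by
      rcases hy.eq_or_lt with h | h
      · rw [← h, mul_zero, Real.zero_rpow (by linarith)]
      · rw [← Real.rpow_add_one h.ne']; congr 1; ring
    rw [hq]
    rcases le_total (U y) (1 / 2) with h | h
    · have := Real.rpow_le_rpow hy h hP0.le
      have h2 : 0 ≤ U y ^ (P + 1) := by positivity
      linarith
    · rw [Real.rpow_add_one (by linarith)]
      have h2 : 0 ≤ U y ^ P := by positivity
      have h3 : (0:ℝ) ≤ (1 / 2) ^ P := by positivity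
      nlinarith
  have hκ : ∀ t ∈ Set.Ico 0 (7 / 4 * ϱ0), ∫ y in ball cn t, lap (fun x => M - U x) y ≤ K / P := by
    intro t ht
    have hbt : ball cn t ⊆ ball cn (7 / 4 * ϱ0) := ball_subset_ball ht.2.le
    calc ∫ y in ball cn t, lap (fun x => M - U x) y
        = ∫ y in ball cn t, |U y| ^ (P - 1) * U y :=
          setIntegral_congr_fun measurableSet_ball fun y hy => hlap y (hbt hy)
      _ ≤ ∫ y in ball cn t, (2 * |U y| ^ (P + 1) + (1 / 2 : ℝ) ^ P) := by
          refine setIntegral_mono_on ?_ (hint.mono_set (hbt.trans hballΩ)) measurableSet_ball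
            fun y hy => hpt y (hUpos y (hbt hy))
          have : ContinuousOn (fun y => |U y| ^ (P - 1) * U y) (closure Ω) :=
            (s2.abs.rpow_const fun y _ => Or.inr (by linarith)).mul s2
          exact (this.integrableOn_compact hcomp).mono_set
            ((hbt.trans hballΩ).trans subset_closure)
      _ ≤ ∫ y in Ω, (2 * |U y| ^ (P + 1) + (1 / 2 : ℝ) ^ P) := by
          refine setIntegral_mono_set hint ?_ (hbt.trans hballΩ).eventuallyLE
          exact Filter.Eventually.of_forall fun y => by
            simp only [Pi.zero_apply]; positivity
      _ = 2 * (∫ y in Ω, |U y| ^ (P + 1)) + (1 / 2 : ℝ) ^ P * volume.real Ω := by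
          have hfin : IntegrableOn (fun _ : E2 => (1 / 2 : ℝ) ^ P) Ω :=
            integrableOn_const (hΩb.measure_lt_top.ne)
          rw [integral_add (hint1.const_mul 2) hfin, integral_const_mul, setIntegral_const,
            smul_eq_mul, mul_comm (volume.real Ω)]
      _ ≤ K / P := by
          rw [le_div_iff₀ hP0]
          have h1 := bernoulli_base_two (p := P) hp.le
          have h2 : (1 / 2 : ℝ) ^ P * P ≤ 1 := by
            rw [Real.div_rpow (by norm_num) (by norm_num), Real.one_rpow, one_div_mul_eq_div,
              div_le_one (by positivity)]
            linarith
          have h3 : 0 ≤ volume.real Ω := measureReal_nonneg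
          have h4 := mul_le_mul_of_nonneg_right h2 h3
          rw [hK]
          linarith
  have hzn : ‖cn + ep • z - cn‖ = ep * ‖z‖ := by
    rw [add_sub_cancel_left, norm_smul, Real.norm_of_nonneg hεn.le]
  have hzle : ep * ‖z‖ ≤ ϱ0 := by
    rw [le_div_iff₀ hεn] at hz
    linarith
  have main := W_log (W := fun x => M - U x) (c := cn) (z := cn + ep • z) (R := 7 / 4 * ϱ0)
    (A := M ^ (P - 1) * M) (κ := K / P) (ε := ep) ?_ ?_ ?_ hκ hεn (by simp [hMdef]) ?_ ?_
  · rw [hzn, mul_div_cancel_left₀ _ hεn.ne'] at main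
    have hcc : cn + ep • z ∈ closure Ω := by
      apply subset_closure (hballΩ _)
      rw [mem_ball_iff_norm, hzn]
      linarith
    have hle := hcm _ hcc
    have hL : 0 ≤ Real.log (2 + ‖z‖) := Real.log_nonneg (by linarith [norm_nonneg z])
    have hA : M ^ (P - 1) * M * ep ^ 2 = M / P := by
      rw [eq_div_iff hP0.ne']
      linear_combination M * hεd
    rw [abs_mul, abs_of_pos (by positivity), abs_sub_comm, abs_of_nonneg (by linarith)]
    have e5 : 9 / π * (π * (M ^ (P - 1) * M) * ep ^ 2 + 2 * (K / P)) =
        M / P * (9 / π * (π + 2 * K / M)) := by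
      rw [mul_assoc π, hA]
      field_simp
    rw [e5] at main
    calc P / M * (M - U (cn + ep • z))
        ≤ P / M * (M / P * (9 / π * (π + 2 * K / M)) * Real.log (2 + ‖z‖)) :=
          mul_le_mul_of_nonneg_left main (by positivity)
      _ = 9 / π * (π + 2 * K / M) * Real.log (2 + ‖z‖) := by field_simp
      _ ≤ 9 / π * (π + 4 * K) * Real.log (2 + ‖z‖) := by
          have : 2 * K / M ≤ 4 * K := by
            rw [div_le_iff₀ hM]
            nlinarith
          gcongr
  · exact contDiffOn_const.sub (s1.mono hballΩ)
  · intro y hy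
    rw [hlap y hy]
    exact mul_nonneg (by positivity) (hUpos y hy)
  · intro y hy
    rw [hlap y hy]
    exact nonlin_le hp (hcm y (subset_closure (hballΩ hy))) hM
  · intro y hy
    exact sub_nonneg.2 (hcm y (subset_closure (hballΩ hy)))
  · rw [hzn]
    linarith

/-- Lemma 3.7: global logarithmic bound `|v_{i,p}(z)| ≤ C log(2+|z|)`. -/
theorem rescaled_global_log_bound
    (Ω : Set E2) (hΩo : IsOpen Ω) (hΩb : IsBounded Ω) (hΩne : Ω.Nonempty)
    (p : ℕ → ℝ) (hp1 : ∀ n, 1 < p n) (hptop : Tendsto p atTop atTop)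
    (u : ℕ → E2 → ℝ)
    (hsol : ∀ n, IsSolution Ω (p n) (u n))
    (hnod : ∀ n, IsNodal Ω (u n))
    (hlow : Tendsto (fun n => p n * ∫ x in Ω, |u n x| ^ (p n + 1)) atTop
      (𝓝 (16 * π * Real.exp 1)))
    (xl : Fin 2 → ℕ → E2)
    (hmax : ∀ n, xl 0 n ∈ Ω ∧ ∀ y ∈ closure Ω, u n y ≤ u n (xl 0 n))
    (hmin : ∀ n, xl 1 n ∈ Ω ∧ ∀ y ∈ closure Ω, u n (xl 1 n) ≤ u n y)
    (x : Fin 2 → E2) (hx : ∀ i, x i ∈ Ω) (hxne : x 0 ≠ x 1)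
    (hxconv : ∀ i, Tendsto (fun n => xl i n) atTop (𝓝 (x i)))
    (ε : Fin 2 → ℕ → ℝ) (hεpos : ∀ i n, 0 < ε i n)
    (hεdef : ∀ i n, (ε i n) ^ 2 * (p n * |u n (xl i n)| ^ (p n - 1)) = 1)
    (v : Fin 2 → ℕ → E2 → ℝ)
    (hv : ∀ i n z, v i n z =
      (p n / u n (xl i n)) * (u n (xl i n + ε i n • z) - u n (xl i n)))
    (r0 : ℝ) (hr0 : 0 < r0)
    (hdisj : Disjoint (ball (x 0) (2 * r0)) (ball (x 1) (2 * r0)))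
    (ϱ0 : ℝ) (hϱ0 : ϱ0 ∈ Set.Ioo (0:ℝ) (r0 / 2)) (N0 : ℕ)
    (hsign : ∀ n ≥ N0,
      (∀ y ∈ ball (x 0) (2 * ϱ0), 1 / p n ≤ u n y) ∧
      (∀ y ∈ ball (x 1) (2 * ϱ0), u n y ≤ -(1 / p n)))
    :
    ∃ C > (0:ℝ), ∃ N : ℕ, ∀ n ≥ N, ∀ i : Fin 2, ∀ z : E2,
      ‖z‖ ≤ ϱ0 / ε i n → |v i n z| ≤ C * Real.log (2 + ‖z‖) := by
  have hpos0 : ∀ n, 0 < u n (xl 0 n) := by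
    intro n
    obtain ⟨y, hy, hy'⟩ := (hnod n).1
    exact hy'.trans_le ((hmax n).2 y (subset_closure hy))
  have hpos1 : ∀ n, 0 < -u n (xl 1 n) := by
    intro n
    obtain ⟨y, hy, hy'⟩ := (hnod n).2
    have := (hmin n).2 y (subset_closure hy)
    linarith
  obtain ⟨C0, hC0, N1, h0⟩ := one_sided Ω hΩo hΩb p hp1 hptop u hsol hlow (xl 0) hmax hpos0
    (x 0) (hx 0) (hxconv 0) (ε 0) (hεpos 0) (hεdef 0) ϱ0 hϱ0.1 N0 (fun n hn => (hsign n hn).1)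
  obtain ⟨C1, hC1, N2, h1⟩ := one_sided Ω hΩo hΩb p hp1 hptop (fun n x => -u n x)
    (fun n => isSolution_neg (hsol n)) (by simpa only [abs_neg] using hlow) (xl 1)
    (fun n => ⟨(hmin n).1, fun y hy => neg_le_neg ((hmin n).2 y hy)⟩) hpos1
    (x 1) (hx 1) (hxconv 1) (ε 1) (hεpos 1) (by simpa only [abs_neg] using hεdef 1)
    ϱ0 hϱ0.1 N0 (fun n hn y hy => by linarith [(hsign n hn).2 y hy])
  refine ⟨max C0 C1, lt_max_of_lt_left hC0, max N1 N2, fun n hn i z hz => ?_⟩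
  have hL : 0 ≤ Real.log (2 + ‖z‖) := Real.log_nonneg (by linarith [norm_nonneg z])
  fin_cases i
  · have := h0 n ((le_max_left _ _).trans hn) z hz
    change |v 0 n z| ≤ _
    rw [hv]
    exact this.trans (mul_le_mul_of_nonneg_right (le_max_left _ _) hL)
  · have := h1 n ((le_max_right _ _).trans hn) z hz
    change |v 1 n z| ≤ _
    rw [hv]
    refine le_trans (le_of_eq ?_) (this.trans (mul_le_mul_of_nonneg_right (le_max_right _ _) hL))
    congr 1
    rw [div_neg]
    ring

end
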